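/- Let n ≥ 3 and 3 ≤ k ≤ n. Consider n random lengths drawn independently and uniformly from [0,1], with increasing rearrangement X_(1) ≤ ⋯ ≤ X_(n). Then the probability that X_(i) + ⋯ + X_(i+k−2) < X_(i+k−1) for every 1 ≤ i ≤ n−k+1 (no k-gon can be formed) equals 1 / ( (∏_{ℓ=1}^{k−3} T_{k,ℓ}(n)) · (∏_{i=1}^{n−k+3} S_k(i)) ). -/

import Mathlib

open MeasureTheory Finset ENNReal

/-- `T k ℓ` : the `(k-1)`-bonacci sequence with initial terms
`T k ℓ 1 = ⋯ = T k ℓ (ℓ-1) = 0`, `T k ℓ ℓ = ⋯ = T k ℓ (k-1) = 1` and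
recurrence `T k ℓ m = ∑_{p=1}^{k-1} T k ℓ (m-p)` for `m ≥ k`. -/
def T (k ℓ : ℕ) : ℕ → ℕ
  | m =>
    if m < k then (if ℓ ≤ m then 1 else 0)
    else if h0 : m = 0 then 0
    else ∑ p ∈ (Finset.range (k - 1)).attach, T k ℓ (m - (↑p + 1))
  termination_by m => m
  decreasing_by omega

/-- `S k` : the `(k-1)`-bonacci sequence with `S k 1 = 1`, `S k i = 2^(i-2)` for
`2 ≤ i ≤ k-1`, and recurrence `S k m = ∑_{p=1}^{k-1} S k (m-p)` for `m ≥ k`. -/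
def S (k : ℕ) : ℕ → ℕ
  | m =>
    if h0 : m = 0 then 0
    else if m = 1 then 1
    else if m < k then 2 ^ (m - 2)
    else ∑ p ∈ (Finset.range (k - 1)).attach, S k (m - (↑p + 1))
  termination_by m => m
  decreasing_by omega

/-- No `k`-gon can be formed from the (increasingly sorted) stick lengths `y`:
for every window of `k` consecutive entries, i.e. every (0-indexed) `i` with
`i + (k-1) < n`, one has `y i + ⋯ + y (i+k-2) < y (i+k-1)`. -/
def NoPolygon (n k : ℕ) (y : Fin n → ℝ) : Prop :=
  ∀ i : ℕ, ∀ hi : i + (k - 1) < n,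
    (∑ j : Fin (k - 1), y ⟨i + j, by have := j.isLt; omega⟩) < y ⟨i + (k - 1), hi⟩

/-- The entries whose sum the `m`-th sorted length must exceed. -/
def precedingWindow (k m : ℕ) : Finset ℕ :=
  if m < k - 1 then Finset.Ico (m - 1) m else Finset.Ico (m - (k - 1)) m

theorem lt_of_mem_precedingWindow {k m j : ℕ} (h : j ∈ precedingWindow k m) : j < m := by
  unfold precedingWindow at h
  split_ifs at h <;> simp only [Finset.mem_Ico] at h <;> omega

theorem pred_mem_precedingWindow {k m : ℕ} (hk : 2 ≤ k) (hm : 0 < m) :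
    m - 1 ∈ precedingWindow k m := by
  unfold precedingWindow
  split_ifs <;> simp only [Finset.mem_Ico] <;> omega

/-- The `m`-th entry of the sequence whose excesses over `precedingWindow` sums vanish
except for a unit excess at `i`. -/
def impulse (k i : ℕ) : ℕ → ℕ
  | m => (if i = m then 1 else 0) +
      ∑ j ∈ (precedingWindow k m).attach, impulse k i j
  termination_by m => m
  decreasing_by exact lt_of_mem_precedingWindow j.2

theorem impulse_eq (k i m : ℕ) :
    impulse k i m = (if i = m then 1 else 0) + ∑ j ∈ precedingWindow k m, impulse k i j := by
  rw [impulse, Finset.sum_attach (precedingWindow k m) (impulse k i)]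

theorem impulse_pos {k i m : ℕ} (hk : 2 ≤ k) (h : i ≤ m) : 0 < impulse k i m := by
  induction m, h using Nat.le_induction with
  | base => rw [impulse_eq, if_pos rfl]; omega
  | succ m h ih =>
    rw [impulse_eq]
    have := Finset.single_le_sum (f := impulse k i) (fun _ _ => Nat.zero_le _)
      (pred_mem_precedingWindow hk m.succ_pos)
    simp only [Nat.succ_eq_add_one, Nat.add_sub_cancel] at this
    omega

theorem precedingWindow_two_succ (m : ℕ) : precedingWindow 2 (m + 1) = {m} := by
  simp [precedingWindow]

theorem impulse_of_lt {k i m : ℕ} (h : m < i) : impulse k i m = 0 := by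
  induction m using Nat.strong_induction_on with
  | _ m ih =>
    rw [impulse_eq, if_neg (by omega), zero_add]
    exact Finset.sum_eq_zero fun j hj =>
      ih j (lt_of_mem_precedingWindow hj) ((lt_of_mem_precedingWindow hj).trans h)

theorem impulse_two {i m : ℕ} (h : i ≤ m) : impulse 2 i m = 1 := by
  induction m, h using Nat.le_induction with
  | base =>
    rw [impulse_eq, if_pos rfl]
    simp only [Nat.add_eq_left]
    exact Finset.sum_eq_zero fun j hj => impulse_of_lt (lt_of_mem_precedingWindow hj)
  | succ m h ih => rw [impulse_eq, if_neg (by omega), precedingWindow_two_succ]; simp [ih]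

theorem sum_precedingWindow {M : Type*} [AddCommMonoid M] {k m : ℕ} (h : k - 1 ≤ m)
    (f : ℕ → M) :
    ∑ j ∈ precedingWindow k m, f j = ∑ p ∈ Finset.range (k - 1), f (m - (p + 1)) := by
  rw [precedingWindow, if_neg (by omega), Finset.sum_Ico_eq_sum_range,
    ← Finset.sum_range_reflect, show m - (m - (k - 1)) = k - 1 by omega]
  refine Finset.sum_congr rfl fun p hp => ?_
  rw [Finset.mem_range] at hp
  congr 1
  omega

theorem T_of_lt {k ℓ m : ℕ} (h : m < k) : T k ℓ m = if ℓ ≤ m then 1 else 0 := by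
  rw [T, if_pos h]

theorem T_of_le {k ℓ m : ℕ} (hk : 0 < k) (h : k ≤ m) :
    T k ℓ m = ∑ p ∈ Finset.range (k - 1), T k ℓ (m - (p + 1)) := by
  rw [T, if_neg (by omega), dif_neg (by omega),
    Finset.sum_attach (Finset.range (k - 1)) (fun p => T k ℓ (m - (p + 1)))]

theorem impulse_eq_T {k i : ℕ} (hi : i < k - 1) (m : ℕ) :
    impulse k i m = T k (i + 1) (m + 1) := by
  induction m using Nat.strong_induction_on with
  | _ m ih =>
    rw [impulse_eq]
    by_cases hm : m < k - 1
    · rw [T_of_lt (by omega), precedingWindow, if_pos hm]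
      rcases m with _ | m
      · simp
      · have := ih m (by omega)
        rw [T_of_lt (by omega)] at this
        simp only [Nat.add_sub_cancel, Nat.Ico_succ_singleton, Finset.sum_singleton, this]
        split_ifs <;> omega
    · rw [T_of_le (by omega) (by omega), if_neg (by omega), zero_add,
        sum_precedingWindow (by omega)]
      refine Finset.sum_congr rfl fun p hp => ?_
      rw [Finset.mem_range] at hp
      rw [ih _ (by omega)]
      congr 1
      omega

theorem S_zero (k : ℕ) : S k 0 = 0 := by
  rw [S]; simp

theorem S_one (k : ℕ) : S k 1 = 1 := by
  rw [S]; simp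

theorem S_of_lt {k m : ℕ} (h₂ : 2 ≤ m) (h : m < k) : S k m = 2 ^ (m - 2) := by
  rw [S, dif_neg (by omega), if_neg (by omega), if_pos h]

theorem sum_range_S {k m : ℕ} (h : m + 2 ≤ k) :
    ∑ p ∈ Finset.range (m + 2), S k p = 2 ^ m := by
  induction m with
  | zero => simp [Finset.sum_range_succ, S_zero, S_one]
  | succ m ih =>
    rw [Finset.sum_range_succ, ih (by omega), S_of_lt (by omega) (by omega), pow_succ]
    simp
    ring

theorem S_eq_sum {k m : ℕ} (h₂ : 2 ≤ m) :
    S k m = ∑ p ∈ Finset.range (k - 1), S k (m - (p + 1)) := by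
  by_cases h : m < k
  · rw [S_of_lt h₂ h, ← sum_range_S (k := k) (by omega), show m - 2 + 2 = m by omega,
      ← Finset.sum_range_reflect]
    refine Finset.sum_subset_zero_on_sdiff (f := fun p => S k (m - 1 - p)) ?_ ?_ ?_
    · intro p hp
      simp only [Finset.mem_range] at hp ⊢
      omega
    · intro p hp
      simp only [Finset.mem_sdiff, Finset.mem_range] at hp
      rw [show m - (p + 1) = 0 by omega, S_zero]
    · intro p _
      congr 1
      omega
  · rw [S, dif_neg (by omega), if_neg (by omega), if_neg h,
      Finset.sum_attach (Finset.range (k - 1)) (fun p => S k (m - (p + 1)))]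

theorem impulse_eq_S {k i : ℕ} (hk : 3 ≤ k) (hi : k - 3 ≤ i) (m : ℕ) :
    impulse k i m = S k (m + 1 - i) := by
  induction m using Nat.strong_induction_on with
  | _ m ih =>
    rcases lt_trichotomy m i with h | rfl | h
    · rw [impulse_of_lt h, show m + 1 - i = 0 by omega, S_zero]
    · rw [impulse_eq, if_pos rfl, show m + 1 - m = 1 by omega, S_one,
        Finset.sum_eq_zero fun j hj => impulse_of_lt (lt_of_mem_precedingWindow hj), add_zero]
    · rw [impulse_eq, if_neg (by omega), zero_add]
      by_cases hm : m < k - 1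
      · obtain rfl : m = i + 1 := by omega
        rw [precedingWindow, if_pos hm, show i + 1 + 1 - i = 2 by omega, S_of_lt le_rfl (by omega)]
        simp only [Nat.add_sub_cancel, Nat.Ico_succ_singleton, Finset.sum_singleton]
        rw [ih i (by omega), show i + 1 - i = 1 by omega, S_one]
        rfl
      · rw [sum_precedingWindow (by omega), S_eq_sum (by omega)]
        refine Finset.sum_congr rfl fun p hp => ?_
        rw [Finset.mem_range] at hp
        rw [ih _ (by omega)]
        congr 1
        omega

theorem prod_impulse {n k : ℕ} (hk : 3 ≤ k) (hkn : k ≤ n) :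
    ∏ i ∈ Finset.range n, impulse k i (n - 1) =
      (∏ ℓ ∈ Finset.Icc 1 (k - 3), T k ℓ n) * ∏ i ∈ Finset.Icc 1 (n - k + 3), S k i := by
  rw [← Finset.prod_range_mul_prod_Ico _ (show k - 3 ≤ n by omega)]
  congr 1
  · refine Finset.prod_bij' (fun i _ => i + 1) (fun ℓ _ => ℓ - 1) ?_ ?_ ?_ ?_ ?_
    all_goals intro i hi; simp only [Finset.mem_range, Finset.mem_Icc] at hi ⊢; try omega
    rw [impulse_eq_T (by omega), show n - 1 + 1 = n by omega]
  · refine Finset.prod_bij' (fun i _ => n - i) (fun i _ => n - i) ?_ ?_ ?_ ?_ ?_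
    all_goals intro i hi; simp only [Finset.mem_Ico, Finset.mem_Icc] at hi ⊢; try omega
    rw [impulse_eq_S hk (by omega), show n - 1 + 1 - i = n - i by omega]

theorem eq_sum_impulse (k : ℕ) {N m : ℕ} (hm : m < N) (y : ℕ → ℝ) :
    y m = ∑ i ∈ Finset.range N,
      (impulse k i m : ℝ) * (y i - ∑ j ∈ precedingWindow k i, y j) := by
  induction m using Nat.strong_induction_on with
  | _ m ih =>
    have hsum : ∑ j ∈ precedingWindow k m, y j = ∑ i ∈ Finset.range N,
        (∑ j ∈ precedingWindow k m, (impulse k i j : ℝ)) *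
          (y i - ∑ j ∈ precedingWindow k i, y j) := by
      simp_rw [Finset.sum_mul]
      rw [Finset.sum_comm]
      exact Finset.sum_congr rfl fun j hj =>
        ih j (lt_of_mem_precedingWindow hj) ((lt_of_mem_precedingWindow hj).trans hm)
    simp_rw [impulse_eq k _ m]
    push_cast
    simp_rw [add_mul]
    rw [Finset.sum_add_distrib, ← hsum]
    simp [hm]

/-- The sorted length vectors in the unit cube, with distinct entries, forming no `k`-gon. -/
def sortedNoPolygon (n k : ℕ) : Set (Fin n → ℝ) :=
  {y | StrictMono y ∧ (∀ i, y i ∈ Set.Icc (0 : ℝ) 1) ∧ NoPolygon n k y}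

/-- The corner simplex of the unit cube, without its facets `v i = 0` for `i > 0`. -/
def cornerSimplex (n : ℕ) : Set (Fin n → ℝ) :=
  {v | (∀ i, 0 ≤ v i) ∧ (∀ i : Fin n, 0 < (i : ℕ) → 0 < v i) ∧ ∑ i, v i ≤ 1}

theorem mem_sortedNoPolygon_iff {n k : ℕ} (hk : 2 ≤ k) (hn : 0 < n) (y : ℕ → ℝ) :
    (fun i : Fin n => y i) ∈ sortedNoPolygon n k ↔
      (∀ i < n, 0 ≤ y i - ∑ j ∈ precedingWindow k i, y j) ∧
      (∀ i < n, 0 < i → 0 < y i - ∑ j ∈ precedingWindow k i, y j) ∧ y (n - 1) ≤ 1 := by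
  have hwin : ∀ i, ∑ j ∈ precedingWindow k (i + (k - 1)), y j = ∑ j : Fin (k - 1), y (i + j) := by
    intro i
    rw [precedingWindow, if_neg (by omega), Finset.sum_Ico_eq_sum_range,
      Finset.sum_range, show i + (k - 1) - (i + (k - 1) - (k - 1)) = k - 1 by omega]
    simp
  constructor
  · rintro ⟨hmono, hcube, hpoly⟩
    have hpos : ∀ i < n, 0 < i → 0 < y i - ∑ j ∈ precedingWindow k i, y j := by
      intro i hi h0
      by_cases hik : i < k - 1
      · have : y (i - 1) < y i :=
          hmono (a := ⟨i - 1, by omega⟩) (b := ⟨i, hi⟩) (Fin.mk_lt_mk.2 (by omega))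
        obtain ⟨i, rfl⟩ := Nat.exists_eq_succ_of_ne_zero h0.ne'
        rw [precedingWindow, if_pos hik]
        simp only [Nat.succ_eq_add_one, Nat.add_sub_cancel, Nat.Ico_succ_singleton,
          Finset.sum_singleton] at this ⊢
        linarith
      · obtain ⟨i, rfl⟩ := Nat.exists_eq_add_of_le' (not_lt.1 hik)
        rw [hwin]
        exact sub_pos.2 (hpoly i hi)
    refine ⟨fun i hi => ?_, hpos, (hcube ⟨n - 1, by omega⟩).2⟩
    rcases Nat.eq_zero_or_pos i with rfl | h0
    · have : precedingWindow k 0 = ∅ := by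
        simp [precedingWindow]
      simpa [this] using (hcube ⟨0, hi⟩).1
    · exact (hpos i hi h0).le
  · rintro ⟨hnonneg, hpos, hlast⟩
    have h0 : ∀ i < n, 0 ≤ y i := by
      intro i
      induction i using Nat.strong_induction_on with
      | _ i ih =>
        intro hi
        have := Finset.sum_nonneg fun j (hj : j ∈ precedingWindow k i) =>
          ih j (lt_of_mem_precedingWindow hj) ((lt_of_mem_precedingWindow hj).trans hi)
        linarith [hnonneg i hi]
    have hstep : ∀ i, i + 1 < n → y i < y (i + 1) := by
      intro i hi
      have := Finset.single_le_sum (f := y)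
        (fun j (hj : j ∈ precedingWindow k (i + 1)) =>
          h0 j ((lt_of_mem_precedingWindow hj).trans hi))
        (pred_mem_precedingWindow hk i.succ_pos)
      simp only [Nat.add_sub_cancel] at this
      linarith [hpos (i + 1) hi i.succ_pos]
    have hmono : StrictMono (fun i : Fin n => y i) := by
      obtain ⟨n, rfl⟩ := Nat.exists_eq_succ_of_ne_zero hn.ne'
      refine Fin.strictMono_iff_lt_succ.2 fun i => ?_
      simpa using hstep i (by omega)
    refine ⟨hmono, fun i => ⟨h0 i i.2, le_trans ?_ hlast⟩, fun i hi => ?_⟩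
    · exact hmono.monotone (a := i) (b := ⟨n - 1, by omega⟩) (Fin.mk_le_mk.2 (by omega))
    · have := hpos (i + (k - 1)) hi (by omega)
      rw [hwin] at this
      exact sub_pos.1 this

/-- The linear map taking a sorted length vector to its excesses over `precedingWindow` sums,
weighted by their contributions to the largest length. -/
def excessMatrix (n k : ℕ) : Matrix (Fin n) (Fin n) ℝ :=
  Matrix.of fun i j => (impulse k i (n - 1) : ℝ) *
    ((if i = j then 1 else 0) - if (j : ℕ) ∈ precedingWindow k i then 1 else 0)

theorem det_excessMatrix (n k : ℕ) :
    (excessMatrix n k).det = ∏ i ∈ Finset.range n, (impulse k i (n - 1) : ℝ) := by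
  rw [Matrix.det_of_isLowerTriangular, Finset.prod_range]
  · refine Finset.prod_congr rfl fun i _ => ?_
    have : (i : ℕ) ∉ precedingWindow k i := fun h => (lt_of_mem_precedingWindow h).false
    simp [excessMatrix, this]
  · intro i j hij
    have hij : i < j := hij
    have : (j : ℕ) ∉ precedingWindow k i :=
      fun h => absurd (lt_of_mem_precedingWindow h) (by simpa using hij.le)
    simp [excessMatrix, this, hij.ne]

theorem excessMatrix_mulVec {n k : ℕ} (y : ℕ → ℝ) (i : Fin n) :
    (excessMatrix n k).mulVec (fun j => y j) i =
      impulse k i (n - 1) * (y i - ∑ j ∈ precedingWindow k i, y j) := by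
  have hwin : ∑ j : Fin n, (if (j : ℕ) ∈ precedingWindow k i then y j else 0) =
      ∑ j ∈ precedingWindow k i, y j := by
    rw [Fin.sum_univ_eq_sum_range (fun j => if j ∈ precedingWindow k i then y j else 0) n,
      Finset.sum_ite_mem, Finset.inter_eq_right.2]
    exact fun j hj => Finset.mem_range.2 ((lt_of_mem_precedingWindow hj).trans i.2)
  simp only [Matrix.mulVec, dotProduct, excessMatrix, Matrix.of_apply, mul_assoc,
    ← Finset.mul_sum, sub_mul, ite_mul, one_mul, zero_mul, Finset.sum_sub_distrib, hwin]
  simp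

theorem sortedNoPolygon_eq_preimage {n k : ℕ} (hk : 2 ≤ k) (hn : 0 < n) :
    sortedNoPolygon n k = Matrix.toLin' (excessMatrix n k) ⁻¹' cornerSimplex n := by
  ext z
  obtain ⟨y, rfl⟩ : ∃ y : ℕ → ℝ, z = fun i : Fin n => y i :=
    ⟨fun i => if h : i < n then z ⟨i, h⟩ else 0, by ext i; simp⟩
  have hpos (i : Fin n) : (0 : ℝ) < impulse k i (n - 1) :=
    Nat.cast_pos.2 (impulse_pos hk (by omega))
  have hnonneg_iff (i : Fin n) (t : ℝ) : 0 ≤ impulse k i (n - 1) * t ↔ 0 ≤ t :=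
    mul_nonneg_iff_of_pos_left (hpos i)
  have hpos_iff (i : Fin n) (t : ℝ) : 0 < impulse k i (n - 1) * t ↔ 0 < t :=
    mul_pos_iff_of_pos_left (hpos i)
  rw [mem_sortedNoPolygon_iff hk hn, eq_sum_impulse k (Nat.sub_one_lt_of_lt hn) y,
    Finset.sum_range]
  simp only [cornerSimplex, Set.mem_preimage, Set.mem_ofPred_eq, Matrix.toLin'_apply,
    excessMatrix_mulVec, hnonneg_iff, hpos_iff]
  simp only [Fin.forall_iff]

theorem volume_sortedNoPolygon {n k : ℕ} (hk : 2 ≤ k) (hn : 0 < n) :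
    volume (sortedNoPolygon n k) =
      (∏ i ∈ Finset.range n, (impulse k i (n - 1) : ℝ≥0∞))⁻¹ * volume (cornerSimplex n) := by
  have hpos : 0 < ∏ i ∈ Finset.range n, impulse k i (n - 1) :=
    Finset.prod_pos fun i hi => impulse_pos hk (by have := Finset.mem_range.1 hi; omega)
  have hdet : LinearMap.det (Matrix.toLin' (excessMatrix n k)) =
      ((∏ i ∈ Finset.range n, impulse k i (n - 1) : ℕ) : ℝ) := by
    rw [LinearMap.det_toLin', det_excessMatrix, Nat.cast_prod]
  rw [sortedNoPolygon_eq_preimage hk hn, Measure.addHaar_preimage_linearMap, hdet,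
    abs_of_nonneg (by positivity), ENNReal.ofReal_inv_of_pos (by exact_mod_cast hpos),
    ENNReal.ofReal_natCast, Nat.cast_prod]
  rw [hdet]
  exact_mod_cast hpos.ne'

theorem volume_setOf_not_injective (n : ℕ) :
    volume {x : Fin n → ℝ | ¬ Function.Injective x} = 0 := by
  have hsub : {x : Fin n → ℝ | ¬ Function.Injective x} ⊆
      ⋃ p : {p : Fin n × Fin n // p.1 ≠ p.2},
        (LinearMap.ker (LinearMap.proj (R := ℝ) (φ := fun _ : Fin n => ℝ) p.1.1 -
          LinearMap.proj p.1.2) : Set (Fin n → ℝ)) := by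
    intro x hx
    simp only [Set.mem_ofPred_eq, Function.Injective, not_forall] at hx
    obtain ⟨i, j, h, hij⟩ := hx
    exact Set.mem_iUnion.2 ⟨⟨(i, j), hij⟩, by simp [h]⟩
  refine measure_mono_null hsub (measure_iUnion_null fun p => ?_)
  refine Measure.addHaar_submodule _ _ fun h => ?_
  have : (Pi.single p.1.1 1 : Fin n → ℝ) ∈ LinearMap.ker
      (LinearMap.proj (R := ℝ) (φ := fun _ : Fin n => ℝ) p.1.1 - LinearMap.proj p.1.2) :=
    h ▸ Submodule.mem_top
  simp [p.2.symm] at this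

theorem volume_setOf_comp_sort {n : ℕ} {P : (Fin n → ℝ) → Prop}
    (hP : MeasurableSet {y | StrictMono y ∧ P y}) :
    volume {x : Fin n → ℝ | P (x ∘ Tuple.sort x)} =
      n.factorial * volume {y : Fin n → ℝ | StrictMono y ∧ P y} := by
  have hperm (σ : Equiv.Perm (Fin n)) :
      MeasurePreserving (fun x : Fin n → ℝ => x ∘ σ) volume volume := by
    convert volume_measurePreserving_piCongrLeft (fun _ : Fin n => ℝ) σ.symm using 1
    ext x i
    simpa using (MeasurableEquiv.piCongrLeft_apply_apply (β := fun _ => ℝ) σ.symm x (σ i)).symm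
  have hunion : {x : Fin n → ℝ | P (x ∘ Tuple.sort x)} =ᵐ[volume]
      ⋃ σ : Equiv.Perm (Fin n), (fun x : Fin n → ℝ => x ∘ σ) ⁻¹' {y | StrictMono y ∧ P y} := by
    have hinj : ∀ᵐ x : Fin n → ℝ, Function.Injective x := volume_setOf_not_injective n
    refine Filter.eventuallyEq_set.2 (hinj.mono fun x hx => ?_)
    simp only [Set.mem_ofPred_eq, Set.mem_iUnion, Set.mem_preimage]
    constructor
    · exact fun h => ⟨Tuple.sort x,
        (Tuple.monotone_sort x).strictMono_of_injective (hx.comp (Tuple.sort x).injective), h⟩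
    · rintro ⟨σ, hσ, h⟩
      rwa [← Tuple.comp_sort_eq_comp_iff_monotone.2 hσ.monotone]
  have hdisj : Pairwise (Function.onFun Disjoint fun σ : Equiv.Perm (Fin n) =>
      (fun x : Fin n → ℝ => x ∘ σ) ⁻¹' {y | StrictMono y ∧ P y}) := by
    intro σ τ hne
    refine Set.disjoint_left.2 fun x hσ hτ => hne (Equiv.ext fun i => ?_)
    have hx : Function.Injective x := by
      have := hσ.1.injective.comp σ.symm.injective
      simpa [Function.comp_assoc] using this
    refine hx (congrFun (f := x ∘ σ) (g := x ∘ τ) ?_ i)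
    rw [Tuple.comp_sort_eq_comp_iff_monotone.2 hσ.1.monotone,
      Tuple.comp_sort_eq_comp_iff_monotone.2 hτ.1.monotone]
  rw [measure_congr hunion, measure_iUnion hdisj fun σ => (hperm σ).measurable hP]
  simp_rw [(hperm _).measure_preimage hP.nullMeasurableSet]
  simp [Fintype.card_perm]

theorem measurableSet_sortedNoPolygon (n k : ℕ) : MeasurableSet (sortedNoPolygon n k) := by
  unfold sortedNoPolygon StrictMono NoPolygon
  measurability

theorem noPolygon_two_of_strictMono {n : ℕ} {y : Fin n → ℝ} (hy : StrictMono y) :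
    NoPolygon n 2 y := by
  intro i hi
  simpa using hy (show (⟨i, by omega⟩ : Fin n) < ⟨i + 1, hi⟩ from Fin.mk_lt_mk.2 i.lt_succ_self)

theorem volume_setOf_noPolygon_sort {n k : ℕ} :
    volume {x : Fin n → ℝ | (∀ i, x i ∈ Set.Icc (0 : ℝ) 1) ∧ NoPolygon n k (x ∘ Tuple.sort x)} =
      n.factorial * volume (sortedNoPolygon n k) := by
  have := volume_setOf_comp_sort (measurableSet_sortedNoPolygon n k)
  rw [sortedNoPolygon, ← this]
  congr 1
  ext x
  simp only [Set.mem_ofPred_eq, Function.comp_apply,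
    (Tuple.sort x).forall_congr_right (q := fun i => x i ∈ Set.Icc (0 : ℝ) 1)]

theorem factorial_mul_volume_cornerSimplex {n : ℕ} (hn : 0 < n) :
    (n.factorial : ℝ≥0∞) * volume (cornerSimplex n) = 1 := by
  have hone : ∏ i ∈ Finset.range n, (impulse 2 i (n - 1) : ℝ≥0∞) = 1 :=
    Finset.prod_eq_one fun i hi => by
      rw [impulse_two (by have := Finset.mem_range.1 hi; omega), Nat.cast_one]
  have hvol := volume_sortedNoPolygon le_rfl hn
  rw [hone, inv_one, one_mul] at hvol
  have hinj : ∀ᵐ x : Fin n → ℝ, Function.Injective x := volume_setOf_not_injective n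
  have hcube : {x : Fin n → ℝ | (∀ i, x i ∈ Set.Icc (0 : ℝ) 1) ∧
      NoPolygon n 2 (x ∘ Tuple.sort x)} =ᵐ[volume] Set.Icc (0 : Fin n → ℝ) 1 := by
    refine Filter.eventuallyEq_set.2 (hinj.mono fun x hx => ?_)
    have := noPolygon_two_of_strictMono ((Tuple.monotone_sort x).strictMono_of_injective
      (hx.comp (Tuple.sort x).injective))
    simp [this, Pi.le_def, forall_and]
  rw [← hvol, ← volume_setOf_noPolygon_sort, measure_congr hcube, Real.volume_Icc_pi]
  simp

/-- **Pick-up sticks, second form of the main theorem.** For `n ≥ 3` and `3 ≤ k ≤ n`,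
the probability that no `k`-gon can be formed equals
`1 / ((∏_{ℓ=1}^{k-3} T_{k,ℓ}(n)) · (∏_{i=1}^{n-k+3} S_k(i)))`. -/
theorem pickup_sticks_no_kgon_prob' (n k : ℕ) (hn : 3 ≤ n) (hk : 3 ≤ k) (hkn : k ≤ n) :
    volume {x : Fin n → ℝ | (∀ i, x i ∈ Set.Icc (0 : ℝ) 1) ∧
        NoPolygon n k (x ∘ Tuple.sort x)} =
      1 / ((∏ ℓ ∈ Finset.Icc 1 (k - 3), (T k ℓ n : ℝ≥0∞)) *
           ∏ i ∈ Finset.Icc 1 (n - k + 3), (S k i : ℝ≥0∞)) := by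
  have hprod := congrArg (Nat.cast (R := ℝ≥0∞)) (prod_impulse hk hkn)
  push_cast at hprod
  rw [volume_setOf_noPolygon_sort, volume_sortedNoPolygon (by omega) (by omega), ← hprod,
    mul_left_comm, factorial_mul_volume_cornerSimplex (by omega), mul_one, one_div]
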